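/- Let n > 2k > 0 and 4 ≤ i ≤ k+1. If F ⊂ ([n] choose k) is intersecting and |F| - d(F) ≥ binom(n-i, k-i+1), where d(F) is the maximum degree of an element, then |F| ≤ binom(n-1,k-1) - binom(n-i,k-1) + binom(n-i,k-i+1). -/

import Mathlib

/-- the maximum degree of an element in the family `F`. -/
def maxDeg {n : ℕ} (F : Finset (Finset (Fin n))) : ℕ :=
  Finset.univ.sup fun l : Fin n => (F.filter fun S => l ∈ S).card

namespace IntersectingFamily

open Finset

/-- A normalized-matching bound: in a ground set with at most `a + r` elements, a family of
`r`-sets is at most as large as any family of `a`-sets containing its shadow on level `a ≤ r`. -/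
lemma card_le_card_of_shadow_subset {α : Type*} [DecidableEq α] {X : Finset α} {a r : ℕ}
    {𝒞 𝒮 : Finset (Finset α)} (h𝒞 : 𝒞 ⊆ X.powersetCard r) (h𝒮 : 𝒮 ⊆ X.powersetCard a)
    (h : ∀ C ∈ 𝒞, ∀ S ⊆ C, #S = a → S ∈ 𝒮) (har : a ≤ r) (hX : #X ≤ a + r) :
    #𝒞 ≤ #𝒮 := by
  have key : #𝒞 * r.choose a ≤ #𝒮 * r.choose a := by
    refine card_mul_le_card_mul (fun C S => S ⊆ C) (fun C hC => ?_) (fun S hS => ?_)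
    · rw [← (mem_powersetCard.1 (h𝒞 hC)).2, ← card_powersetCard]
      refine card_le_card fun S hS => ?_
      rw [mem_powersetCard] at hS
      exact mem_filter.2 ⟨h C hC S hS.1 hS.2, hS.1⟩
    · obtain ⟨hSX, hSa⟩ := mem_powersetCard.1 (h𝒮 hS)
      calc #(bipartiteBelow (fun C S => S ⊆ C) 𝒞 S)
          ≤ #((X \ S).powersetCard (r - a)) := by
            refine card_le_card_of_injOn (· \ S) (fun C hC => ?_) (fun C hC D hD hCD => ?_)
            · obtain ⟨hC, hSC⟩ := mem_filter.1 hC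
              obtain ⟨hCX, hCr⟩ := mem_powersetCard.1 (h𝒞 hC)
              refine mem_coe.2 (mem_powersetCard.2 ⟨sdiff_subset_sdiff hCX subset_rfl, ?_⟩)
              rw [card_sdiff_of_subset hSC, hCr, hSa]
            · have hC := (mem_filter.1 hC).2
              have hD := (mem_filter.1 hD).2
              rw [← sdiff_union_of_subset hC, ← sdiff_union_of_subset hD]
              exact congrArg (· ∪ S) hCD
        _ = (#X - a).choose (r - a) := by
            rw [card_powersetCard, card_sdiff_of_subset hSX, hSa]
        _ ≤ r.choose (r - a) := Nat.choose_le_choose _ (by lia)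
        _ = r.choose a := Nat.choose_symm har
  exact Nat.le_of_mul_le_mul_right key (Nat.choose_pos har)

lemma choose_le_choose_of_le_add {N a r : ℕ} (har : a ≤ r) (hN : N ≤ a + r) :
    N.choose r ≤ N.choose a := by
  have := card_le_card_of_shadow_subset (X := range N) (a := a) (r := r) Subset.rfl Subset.rfl
    (fun C hC S hS hSa => mem_powersetCard.2 ⟨hS.trans (mem_powersetCard.1 hC).1, hSa⟩) har
    (by simpa using hN)
  simpa using this

/-- The members of a family containing `x`, with `x` removed. -/
def link {α : Type*} [DecidableEq α] (x : α) (F : Finset (Finset α)) : Finset (Finset α) :=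
  (F.filter (x ∈ ·)).image (·.erase x)

section link

variable {α : Type*} [DecidableEq α] {x : α} {F : Finset (Finset α)} {S : Finset α}

lemma mem_link : S ∈ link x F ↔ x ∉ S ∧ insert x S ∈ F := by
  simp only [link, mem_image, mem_filter]
  constructor
  · rintro ⟨T, ⟨hT, hx⟩, rfl⟩
    simpa [insert_erase hx] using hT
  · rintro ⟨hx, hS⟩
    exact ⟨_, ⟨hS, mem_insert_self x S⟩, erase_insert hx⟩

lemma card_link : #(link x F) = #(F.filter (x ∈ ·)) := by
  refine card_image_of_injOn fun S hS T hT h => ?_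
  rw [← insert_erase (mem_filter.1 hS).2, ← insert_erase (mem_filter.1 hT).2]
  exact congrArg (insert x) h

lemma card_link_add_card_filter : #(link x F) + #(F.filter (x ∉ ·)) = #F := by
  rw [card_link, card_filter_add_card_filter_not]

end link

lemma card_add_choose_le_card_add_choose {a r p q : ℕ} (har : a ≤ r) (hrp : r ≤ p) (hpq : p ≤ q)
    (hq : q + 1 ≤ a + r) {𝒞 𝒮 : Finset (Finset ℕ)} (h𝒞 : 𝒞 ⊆ (range q).powersetCard r)
    (hp𝒞 : (range p).powersetCard r ⊆ 𝒞) (h𝒮 : 𝒮 ⊆ (range q).powersetCard a)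
    (h : ∀ C ∈ 𝒞, ∀ S ⊆ C, #S = a → S ∈ 𝒮) :
    #𝒞 + p.choose a ≤ #𝒮 + p.choose r := by
  induction q, hpq using Nat.le_induction generalizing 𝒞 𝒮 with
  | base =>
    have h1 : #𝒞 ≤ p.choose r := by simpa using card_le_card h𝒞
    have h2 : p.choose a ≤ #𝒮 := by
      have hcard : #((range p).powersetCard a) = p.choose a := by simp
      rw [← hcard]
      refine card_le_card fun S hS => ?_
      obtain ⟨hSp, hSa⟩ := mem_powersetCard.1 hS
      obtain ⟨C, hSC, hCp, hC⟩ := exists_subsuperset_card_eq hSp (hSa.trans_le har)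
        (by simpa using hrp)
      exact h C (hp𝒞 (mem_powersetCard.2 ⟨hCp, hC⟩)) S hSC hSa
    lia
  | succ q hpq ih =>
    have hsub : ∀ {S : Finset ℕ}, S ⊆ range (q + 1) → q ∉ S → S ⊆ range q := by
      intro S hS hq
      rwa [range_add_one, subset_insert_iff_of_notMem hq] at hS
    have h0 := ih (by lia) (𝒞 := 𝒞.filter (q ∉ ·)) (𝒮 := 𝒮.filter (q ∉ ·)) ?_ ?_ ?_ ?_
    · have h1 := card_le_card_of_shadow_subset (X := range q) (𝒞 := link q 𝒞) (𝒮 := link q 𝒮)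
        (a := a - 1) (r := r - 1) ?_ ?_ ?_ (by lia) (by simp; lia)
      · have e1 := card_link_add_card_filter (x := q) (F := 𝒞)
        have e2 := card_link_add_card_filter (x := q) (F := 𝒮)
        lia
      · intro C hC
        obtain ⟨hq, hC⟩ := mem_link.1 hC
        obtain ⟨hC, hCr⟩ := mem_powersetCard.1 (h𝒞 hC)
        rw [card_insert_of_notMem hq] at hCr
        exact mem_powersetCard.2 ⟨hsub ((subset_insert _ _).trans hC) hq, by lia⟩
      · intro C hC
        obtain ⟨hq, hC⟩ := mem_link.1 hC
        obtain ⟨hC, hCr⟩ := mem_powersetCard.1 (h𝒮 hC)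
        rw [card_insert_of_notMem hq] at hCr
        exact mem_powersetCard.2 ⟨hsub ((subset_insert _ _).trans hC) hq, by lia⟩
      · intro C hC S hSC hS
        obtain ⟨hqC, hC⟩ := mem_link.1 hC
        have hqS : q ∉ S := fun hS => hqC (hSC hS)
        refine mem_link.2 ⟨hqS, h _ hC _ (insert_subset_insert q hSC) ?_⟩
        rw [card_insert_of_notMem hqS]
        lia
    · intro C hC
      obtain ⟨hC, hq⟩ := mem_filter.1 hC
      obtain ⟨hC, hCr⟩ := mem_powersetCard.1 (h𝒞 hC)
      exact mem_powersetCard.2 ⟨hsub hC hq, hCr⟩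
    · intro C hC
      refine mem_filter.2 ⟨hp𝒞 hC, fun h => ?_⟩
      have := mem_range.1 ((mem_powersetCard.1 hC).1 h)
      lia
    · intro C hC
      obtain ⟨hC, hq⟩ := mem_filter.1 hC
      obtain ⟨hC, hCr⟩ := mem_powersetCard.1 (h𝒮 hC)
      exact mem_powersetCard.2 ⟨hsub hC hq, hCr⟩
    · intro C hC S hSC hS
      obtain ⟨hC, hq⟩ := mem_filter.1 hC
      exact mem_filter.2 ⟨h C hC S hSC hS, fun h => hq (hSC h)⟩

section KruskalKatona

variable {m : ℕ}

/-- The `r`-element sets contained in the first `p` elements of `Fin m`. -/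
def initialSets (m p r : ℕ) : Finset (Finset (Fin m)) :=
  (univ.filter fun x : Fin m => x.val < p).powersetCard r

lemma card_initialSets {p r : ℕ} (hp : p ≤ m) : #(initialSets m p r) = p.choose r := by
  rw [initialSets, card_powersetCard]
  congr 1
  rw [Fin.card_filter_val_lt, min_eq_right hp]

lemma isInitSeg_initialSets {p r : ℕ} : Colex.IsInitSeg (initialSets m p r) r := by
  refine ⟨Set.sized_powersetCard _ _, fun A B hA ⟨hBA, hB⟩ => mem_powersetCard.2 ⟨?_, hB⟩⟩
  intro t ht
  rw [mem_filter]
  refine ⟨mem_univ _, ?_⟩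
  have hlt : toColex (image Fin.val B) < toColex (image Fin.val A) := by
    rwa [Colex.toColex_image_lt_toColex_image Fin.val_strictMono]
  refine Colex.forall_lt_mono hlt.le ?_ t (mem_image.2 ⟨t, ht, rfl⟩)
  intro b hb
  obtain ⟨c, hc, rfl⟩ := mem_image.1 hb
  exact (mem_filter.1 ((mem_powersetCard.1 hA).1 hc)).2

lemma exists_isInitSeg_card_eq {r c : ℕ} (hc : c ≤ m.choose r) :
    ∃ 𝒞 : Finset (Finset (Fin m)), Colex.IsInitSeg 𝒞 r ∧ #𝒞 = c := by
  induction c with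
  | zero => exact ⟨∅, Colex.isInitSeg_empty, rfl⟩
  | succ c ih =>
    obtain ⟨𝒞, h𝒞, rfl⟩ := ih (by lia)
    have hne : ((univ : Finset (Fin m)).powersetCard r \ 𝒞).Nonempty := by
      rw [nonempty_iff_ne_empty, Ne, sdiff_eq_empty_iff_subset]
      intro hsub
      have := card_le_card hsub
      rw [card_powersetCard, card_fin] at this
      lia
    obtain ⟨s, hs, hmin⟩ := exists_min_image _ toColex hne
    obtain ⟨hsr, hs𝒞⟩ := mem_sdiff.1 hs
    refine ⟨insert s 𝒞, ⟨?_, ?_⟩, card_insert_of_notMem hs𝒞⟩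
    · intro t ht
      rcases mem_insert.1 (mem_coe.1 ht) with rfl | ht
      · exact (mem_powersetCard.1 hsr).2
      · exact h𝒞.1 ht
    · rintro u t hu ⟨htu, ht⟩
      rcases mem_insert.1 hu with rfl | hu
      · by_contra hcon
        have ht' : t ∉ 𝒞 := fun h => hcon (mem_insert_of_mem h)
        exact (hmin t (mem_sdiff.2 ⟨mem_powersetCard.2 ⟨subset_univ _, ht⟩, ht'⟩)).not_gt htu
      · exact mem_insert_of_mem (h𝒞.2 hu ⟨htu, ht⟩)

lemma isInitSeg_subset_of_card_le {𝒜 ℬ : Finset (Finset (Fin m))} {r : ℕ}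
    (h𝒜 : Colex.IsInitSeg 𝒜 r) (hℬ : Colex.IsInitSeg ℬ r) (h : #𝒜 ≤ #ℬ) : 𝒜 ⊆ ℬ := by
  rcases h𝒜.total hℬ with h' | h'
  · exact h'
  · exact (eq_of_subset_of_card_le h' h).ge

open scoped FinsetFamily

lemma exists_initial_family {𝒜 : Finset (Finset (Fin m))} {a r q : ℕ}
    (h𝒜 : (𝒜 : Set (Finset (Fin m))).Sized r) (har : a ≤ r) (hqm : q ≤ m)
    (hq : #𝒜 ≤ q.choose r) :
    ∃ 𝒞 𝒮 : Finset (Finset ℕ), 𝒞 ⊆ (range q).powersetCard r ∧ 𝒮 ⊆ (range q).powersetCard a ∧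
      (∀ C ∈ 𝒞, ∀ S ⊆ C, #S = a → S ∈ 𝒮) ∧ #𝒞 = #𝒜 ∧ #𝒮 ≤ #(∂^[r - a] 𝒜) ∧
      ∀ p, p.choose r ≤ #𝒜 → p ≤ q → (range p).powersetCard r ⊆ 𝒞 := by
  obtain ⟨𝒟, h𝒟, hcard⟩ := exists_isInitSeg_card_eq (m := m) (r := r) (c := #𝒜)
    (hq.trans (Nat.choose_le_choose _ hqm))
  have h𝒟q : 𝒟 ⊆ initialSets m q r :=
    isInitSeg_subset_of_card_le h𝒟 isInitSeg_initialSets (by rw [card_initialSets hqm]; lia)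
  have hinj : Function.Injective (image (Fin.val : Fin m → ℕ)) :=
    image_injective Fin.val_injective
  refine ⟨𝒟.image (image Fin.val), (∂^[r - a] 𝒟).image (image Fin.val), ?_, ?_, ?_, ?_, ?_, ?_⟩
  · intro C hC
    obtain ⟨D, hD, rfl⟩ := mem_image.1 hC
    obtain ⟨hDq, hDr⟩ := mem_powersetCard.1 (h𝒟q hD)
    refine mem_powersetCard.2 ⟨fun x hx => ?_, by rwa [card_image_of_injective _ Fin.val_injective]⟩
    obtain ⟨y, hy, rfl⟩ := mem_image.1 hx
    exact mem_range.2 (mem_filter.1 (hDq hy)).2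
  · intro S hS
    obtain ⟨T, hT, rfl⟩ := mem_image.1 hS
    obtain ⟨D, hD, hTD, hcardT⟩ := mem_shadow_iterate_iff_exists_mem_card_add.1 hT
    obtain ⟨hDq, hDr⟩ := mem_powersetCard.1 (h𝒟q hD)
    refine mem_powersetCard.2 ⟨fun x hx => ?_, ?_⟩
    · obtain ⟨y, hy, rfl⟩ := mem_image.1 hx
      exact mem_range.2 (mem_filter.1 (hDq (hTD hy))).2
    · rw [card_image_of_injective _ Fin.val_injective]
      lia
  · intro C hC S hSC hS
    obtain ⟨D, hD, rfl⟩ := mem_image.1 hC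
    obtain ⟨T, hTD, rfl⟩ := subset_image_iff.1 hSC
    rw [card_image_of_injective _ Fin.val_injective] at hS
    refine mem_image_of_mem _ (mem_shadow_iterate_iff_exists_mem_card_add.2 ⟨D, hD, ?_, ?_⟩)
    · exact_mod_cast hTD
    · have := h𝒟.1 hD
      lia
  · rw [card_image_of_injective _ hinj, hcard]
  · rw [card_image_of_injective _ hinj]
    exact iterated_kk h𝒜 hcard.le h𝒟
  · intro p hp hpq S hS
    obtain ⟨hSp, hSr⟩ := mem_powersetCard.1 hS
    have hp𝒟 : initialSets m p r ⊆ 𝒟 :=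
      isInitSeg_subset_of_card_le isInitSeg_initialSets h𝒟
        (by rw [card_initialSets (hpq.trans hqm)]; lia)
    have hSm : ∀ x ∈ S, x < m := fun x hx => by
      have := mem_range.1 (hSp hx)
      lia
    refine mem_image.2 ⟨S.attachFin hSm, hp𝒟 (mem_powersetCard.2 ⟨fun x hx => ?_, ?_⟩), ?_⟩
    · rw [mem_attachFin] at hx
      exact mem_filter.2 ⟨mem_univ _, mem_range.1 (hSp hx)⟩
    · rw [card_attachFin, hSr]
    · ext x
      simp only [mem_image, mem_attachFin]
      exact ⟨by rintro ⟨y, hy, rfl⟩; exact hy, fun hx => ⟨⟨x, hSm x hx⟩, hx, rfl⟩⟩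

/-- The complements of one family and the members of the other are related by the shadow. -/
lemma card_add_card_shadow_le {A B : Finset (Finset (Fin m))} {a b : ℕ}
    (hA : (A : Set (Finset (Fin m))).Sized a) (hB : (B : Set (Finset (Fin m))).Sized b)
    (hAB : ∀ S ∈ A, ∀ T ∈ B, (S ∩ T).Nonempty) (hab : a + b ≤ m) :
    #A + #(∂^[m - b - a] Bᶜˢ) ≤ m.choose a := by
  have hBc : (Bᶜˢ : Set (Finset (Fin m))).Sized (m - b) := by simpa using hB.compls
  have hdisj : Disjoint A (∂^[m - b - a] Bᶜˢ) := by
    refine disjoint_left.2 fun S hS hS' => ?_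
    obtain ⟨T, hT, hST, -⟩ := mem_shadow_iterate_iff_exists_mem_card_add.1 hS'
    obtain ⟨x, hx⟩ := hAB S hS _ (mem_compls.1 hT)
    rw [mem_inter, mem_compl] at hx
    exact hx.2 (hST hx.1)
  rw [← card_union_of_disjoint hdisj]
  have hs : ((A ∪ ∂^[m - b - a] Bᶜˢ : Finset (Finset (Fin m))) : Set (Finset (Fin m))).Sized a := by
    rw [coe_union, Set.sized_union]
    refine ⟨hA, ?_⟩
    convert! hBc.shadow_iterate
    lia
  simpa using hs.card_le

end KruskalKatona

section Cross

open scoped FinsetFamily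

variable {α : Type*} {X : Finset α} {A B : Finset (Finset α)} {a b p q : ℕ}

/-- The trace of `S` on `X`, as a set of indices for an enumeration of `X`. -/
noncomputable def toFin [DecidableEq α] (X S : Finset α) : Finset (Fin #X) :=
  univ.filter fun i => (X.equivFin.symm i : α) ∈ S

lemma image_toFin [DecidableEq α] {S : Finset α} (hS : S ⊆ X) :
    (toFin X S).image (fun i => (X.equivFin.symm i : α)) = S := by
  ext x
  simp only [toFin, mem_image, mem_filter, mem_univ, true_and]
  constructor
  · rintro ⟨i, hi, rfl⟩
    exact hi
  · intro hx
    exact ⟨X.equivFin ⟨x, hS hx⟩, by simpa using hx, by simp⟩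

lemma card_toFin [DecidableEq α] {S : Finset α} (hS : S ⊆ X) : #(toFin X S) = #S := by
  conv_rhs => rw [← image_toFin hS]
  exact (card_image_of_injective _ (Subtype.val_injective.comp (Equiv.injective _))).symm

lemma card_image_toFin [DecidableEq α] (hA : A ⊆ X.powersetCard a) :
    #(A.image (toFin X)) = #A := by
  refine card_image_of_injOn fun S hS T hT h => ?_
  rw [← image_toFin (mem_powersetCard.1 (hA hS)).1, ← image_toFin (mem_powersetCard.1 (hA hT)).1]
  exact congrArg _ h

lemma sized_image_toFin [DecidableEq α] (hA : A ⊆ X.powersetCard a) :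
    (A.image (toFin X) : Set (Finset (Fin #X))).Sized a := by
  intro S hS
  obtain ⟨T, hT, rfl⟩ := mem_image.1 (mem_coe.1 hS)
  obtain ⟨hTX, hTa⟩ := mem_powersetCard.1 (hA hT)
  rw [card_toFin hTX, hTa]

lemma inter_nonempty_toFin [DecidableEq α] {S T : Finset α} (hS : S ⊆ X)
    (h : (S ∩ T).Nonempty) : (toFin X S ∩ toFin X T).Nonempty := by
  obtain ⟨x, hx⟩ := h
  obtain ⟨hxS, hxT⟩ := mem_inter.1 hx
  exact ⟨X.equivFin ⟨x, hS hxS⟩, by simp [toFin, hxS, hxT]⟩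

/-- The shadow bound for cross-intersecting families on an arbitrary finite ground set. -/
lemma exists_sized_shadow [DecidableEq α] (hA : A ⊆ X.powersetCard a) (hB : B ⊆ X.powersetCard b)
    (hAB : ∀ S ∈ A, ∀ T ∈ B, (S ∩ T).Nonempty) (hab : a + b ≤ #X) :
    ∃ 𝒜 : Finset (Finset (Fin #X)), (𝒜 : Set (Finset (Fin #X))).Sized (#X - b) ∧ #𝒜 = #B ∧
      #A + #(∂^[#X - b - a] 𝒜) ≤ (#X).choose a := by
  refine ⟨(B.image (toFin X))ᶜˢ, ?_, ?_, ?_⟩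
  · simpa using (sized_image_toFin hB).compls
  · rw [card_compls, card_image_toFin hB]
  · rw [← card_image_toFin hA]
    refine card_add_card_shadow_le (sized_image_toFin hA) (sized_image_toFin hB) ?_ hab
    intro S hS T hT
    obtain ⟨S₀, hS₀, rfl⟩ := mem_image.1 hS
    obtain ⟨T₀, hT₀, rfl⟩ := mem_image.1 hT
    exact inter_nonempty_toFin (mem_powersetCard.1 (hA hS₀)).1 (hAB S₀ hS₀ T₀ hT₀)

/-- If `B` is at least as large as the family of all `b`-sets containing `#X - p` given points,
then `A` misses at least as many sets as if it had to meet those points. -/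
lemma card_add_choose_le [DecidableEq α] (hA : A ⊆ X.powersetCard a) (hB : B ⊆ X.powersetCard b)
    (hAB : ∀ S ∈ A, ∀ T ∈ B, (S ∩ T).Nonempty) (hab : a + b ≤ #X)
    (hbp : #X - b ≤ p) (hp : p ≤ #X) (hpB : p.choose (#X - b) ≤ #B) :
    #A + p.choose a ≤ (#X).choose a := by
  obtain ⟨𝒜, h𝒜, hcard, hle⟩ := exists_sized_shadow hA hB hAB hab
  have := kruskal_katona_lovasz_form (i := #X - b - a) (by lia) hbp hp h𝒜 (by lia)
  rw [show #X - b - (#X - b - a) = a by lia] at this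
  lia

lemma card_add_card_add_choose_le [DecidableEq α] (hA : A ⊆ X.powersetCard a)
    (hB : B ⊆ X.powersetCard b) (hAB : ∀ S ∈ A, ∀ T ∈ B, (S ∩ T).Nonempty) (hab : a + b ≤ #X)
    (hbp : #X - b ≤ p) (hpq : p ≤ q) (hqX : q ≤ #X)
    (hq : q + 1 ≤ a + (#X - b)) (hpB : p.choose (#X - b) ≤ #B) (hBq : #B ≤ q.choose (#X - b)) :
    #A + #B + p.choose a ≤ (#X).choose a + p.choose (#X - b) := by
  obtain ⟨𝒜, h𝒜, hcard, hle⟩ := exists_sized_shadow hA hB hAB hab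
  obtain ⟨𝒞, 𝒮, h𝒞, h𝒮, h, hc, hs, hp⟩ :=
    exists_initial_family h𝒜 (a := a) (by lia) hqX (hcard.trans_le hBq)
  have := card_add_choose_le_card_add_choose (by lia) hbp hpq hq h𝒞 (hp p (by lia) hpq) h𝒮 h
  lia

lemma card_add_card_le [DecidableEq α] (hA : A ⊆ X.powersetCard a) (hB : B ⊆ X.powersetCard b)
    (hAB : ∀ S ∈ A, ∀ T ∈ B, (S ∩ T).Nonempty) (hab : a + b ≤ #X)
    (hqX : q ≤ #X) (hq : q ≤ a + (#X - b)) (hBq : #B ≤ q.choose (#X - b)) :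
    #A + #B ≤ (#X).choose a := by
  obtain ⟨𝒜, h𝒜, hcard, hle⟩ := exists_sized_shadow hA hB hAB hab
  obtain ⟨𝒞, 𝒮, h𝒞, h𝒮, h, hc, hs, -⟩ :=
    exists_initial_family h𝒜 (a := a) (by lia) hqX (hcard.trans_le hBq)
  have := card_le_card_of_shadow_subset h𝒞 h𝒮 h (by lia) (by simpa using hq)
  lia

end Cross

section link

variable {α : Type*} [DecidableEq α] {x y : α} {X : Finset α} {F : Finset (Finset α)} {k : ℕ}

lemma link_filter (hxy : x ≠ y) :
    link x (F.filter (y ∉ ·)) = (link x F).filter (y ∉ ·) := by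
  ext S
  simp only [mem_link, mem_filter, mem_insert, not_or]
  grind

lemma link_subset_powersetCard (hF : F ⊆ X.powersetCard k) :
    link x F ⊆ (X.erase x).powersetCard (k - 1) := by
  intro S hS
  obtain ⟨hx, hS⟩ := mem_link.1 hS
  obtain ⟨hSX, hSk⟩ := mem_powersetCard.1 (hF hS)
  rw [card_insert_of_notMem hx] at hSk
  exact mem_powersetCard.2 ⟨subset_erase.2 ⟨(subset_insert _ _).trans hSX, hx⟩, by lia⟩

lemma filter_subset_powersetCard (hF : F ⊆ X.powersetCard k) :
    F.filter (x ∉ ·) ⊆ (X.erase x).powersetCard k := by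
  intro S hS
  obtain ⟨hS, hx⟩ := mem_filter.1 hS
  obtain ⟨hSX, hSk⟩ := mem_powersetCard.1 (hF hS)
  exact mem_powersetCard.2 ⟨subset_erase.2 ⟨hSX, hx⟩, hSk⟩

end link

section Shifted

variable {n k : ℕ} {F : Finset (Finset ℕ)}

/-- `F` is closed under replacing an element of a member by a smaller one. -/
def IsShifted (F : Finset (Finset ℕ)) : Prop :=
  ∀ S ∈ F, ∀ y ∈ S, ∀ x < y, x ∉ S → insert x (S.erase y) ∈ F

lemma two_mul_card_le (hF : F ⊆ (range (2 * k)).powersetCard k)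
    (hint : ∀ S ∈ F, ∀ T ∈ F, (S ∩ T).Nonempty) : 2 * #F ≤ (2 * k).choose k := by
  have hcard := card_le_card hF
  rw [card_powersetCard, card_range] at hcard
  have := card_add_card_le hF hF hint (q := 2 * k) (by simp; lia) (by simp) (by simp; lia)
    (by simpa [two_mul] using hcard)
  rw [card_range] at this
  lia

lemma IsShifted.filter_notMem {N : ℕ} (hF : F ⊆ (range (N + 1)).powersetCard k)
    (hs : IsShifted F) : IsShifted (F.filter (N ∉ ·)) := by
  intro S hS y hy x hxy hx
  obtain ⟨hS, hN⟩ := mem_filter.1 hS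
  have hyN := mem_range.1 ((mem_powersetCard.1 (hF hS)).1 hy)
  refine mem_filter.2 ⟨hs S hS y hy x hxy hx, ?_⟩
  simp only [mem_insert, mem_erase, not_or, not_and]
  exact ⟨by lia, fun _ => hN⟩

lemma IsShifted.link {N : ℕ} (hF : F ⊆ (range (N + 1)).powersetCard k)
    (hs : IsShifted F) : IsShifted (link N F) := by
  intro S hS y hy x hxy hx
  obtain ⟨hN, hS⟩ := mem_link.1 hS
  have hyN := mem_range.1 ((mem_powersetCard.1 (hF hS)).1 (mem_insert_of_mem hy))
  have h := hs _ hS y (mem_insert_of_mem hy) x hxy (by simp [hx]; lia)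
  have hyN' : y ≠ N := fun h => hN (h ▸ hy)
  refine mem_link.2 ⟨?_, ?_⟩
  · simp only [mem_insert, mem_erase, not_or, not_and]
    exact ⟨by lia, fun _ => hN⟩
  · rwa [insert_comm, ← erase_insert_of_ne hyN'.symm]

lemma IsShifted.inter_nonempty_link {N : ℕ} (hF : F ⊆ (range (N + 1)).powersetCard k)
    (hs : IsShifted F) (hint : ∀ S ∈ F, ∀ T ∈ F, (S ∩ T).Nonempty) (hk : 1 ≤ k)
    (hN : 2 * k ≤ N + 1) : ∀ S ∈ IntersectingFamily.link N F,
      ∀ T ∈ IntersectingFamily.link N F, (S ∩ T).Nonempty := by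
  intro S hS T hT
  have hcS := (mem_powersetCard.1 (link_subset_powersetCard hF hS)).2
  have hcT := (mem_powersetCard.1 (link_subset_powersetCard hF hT)).2
  obtain ⟨hNS, hS⟩ := mem_link.1 hS
  obtain ⟨hNT, hT⟩ := mem_link.1 hT
  obtain ⟨x, hxN, hx⟩ : ∃ x ∈ range N, x ∉ S ∪ T := by
    refine exists_mem_notMem_of_card_lt_card ?_
    have := card_union_le S T
    rw [card_range]
    lia
  rw [mem_range] at hxN
  rw [mem_union, not_or] at hx
  have h := hs _ hS N (mem_insert_self _ _) x hxN (by simp [hx.1]; lia)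
  rw [erase_insert hNS] at h
  obtain ⟨z, hz⟩ := hint _ h _ hT
  refine ⟨z, ?_⟩
  simp only [mem_inter, mem_insert] at hz ⊢
  grind

/-- In a shifted family, the sets missing `0` and the largest point contain the upper shadow of the
link of the largest point. -/
lemma IsShifted.choose_le_card {N p : ℕ} (hF : F ⊆ (range (N + 1)).powersetCard k)
    (hs : IsShifted F) (hk : 1 ≤ k) (hkN : k + 1 ≤ N) (hp : N - k ≤ p) (hpN : p + 1 ≤ N)
    (h : p.choose (N - k) ≤ #((IntersectingFamily.link N F).filter (0 ∉ ·))) :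
    p.choose (N - 1 - k) ≤ #((F.filter (N ∉ ·)).filter (0 ∉ ·)) := by
  set X := (range N).erase 0 with hX
  have hXc : #X = N - 1 := by rw [hX, card_erase_of_mem (by simp; lia), card_range]
  have hXN : (range (N + 1)).erase N = range N := by
    rw [range_add_one, erase_insert notMem_range_self]
  have hB0 : (F.filter (N ∉ ·)).filter (0 ∉ ·) ⊆ X.powersetCard k := by
    have := filter_subset_powersetCard (x := 0) (filter_subset_powersetCard (x := N) hF)
    rwa [hXN] at this
  have hB1 : (IntersectingFamily.link N F).filter (0 ∉ ·) ⊆ X.powersetCard (k - 1) := by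
    have := filter_subset_powersetCard (x := 0) (link_subset_powersetCard (x := N) hF)
    rwa [hXN] at this
  set B0 := (F.filter (N ∉ ·)).filter (0 ∉ ·)
  set B1 := (IntersectingFamily.link N F).filter (0 ∉ ·) with hB1def
  have hA : (X.powersetCard k \ B0).image (X \ ·) ⊆ X.powersetCard (N - 1 - k) := by
    intro S hS
    obtain ⟨U, hU, rfl⟩ := mem_image.1 hS
    obtain ⟨hUX, hUk⟩ := mem_powersetCard.1 (mem_sdiff.1 hU).1
    exact mem_powersetCard.2 ⟨sdiff_subset, by rw [card_sdiff_of_subset hUX, hXc, hUk]⟩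
  have hAc : #((X.powersetCard k \ B0).image (X \ ·)) + #B0 = (N - 1).choose k := by
    rw [card_image_of_injOn, card_sdiff_of_subset hB0, Nat.sub_add_cancel (card_le_card hB0),
      card_powersetCard, hXc]
    intro S hS T hT hST
    have hS := (mem_powersetCard.1 (mem_sdiff.1 hS).1).1
    have hT := (mem_powersetCard.1 (mem_sdiff.1 hT).1).1
    rw [← Finset.sdiff_sdiff_eq_self hS, ← Finset.sdiff_sdiff_eq_self hT]
    exact congrArg (X \ ·) hST
  have hcross : ∀ S ∈ (X.powersetCard k \ B0).image (X \ ·), ∀ T ∈ B1, (S ∩ T).Nonempty := by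
    intro S hS T hT
    obtain ⟨U, hU, rfl⟩ := mem_image.1 hS
    obtain ⟨hU, hUB⟩ := mem_sdiff.1 hU
    obtain ⟨hUX, hUk⟩ := mem_powersetCard.1 hU
    obtain ⟨hTX, hTk⟩ := mem_powersetCard.1 (hB1 hT)
    rw [hB1def, mem_filter, mem_link] at hT
    obtain ⟨⟨hNT, hT⟩, h0⟩ := hT
    by_contra hemp
    rw [not_nonempty_iff_eq_empty] at hemp
    have hTU : T ⊆ U := by
      intro z hz
      by_contra hzU
      have : z ∈ (X \ U) ∩ T := mem_inter.2 ⟨mem_sdiff.2 ⟨hTX hz, hzU⟩, hz⟩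
      rw [hemp] at this
      exact notMem_empty _ this
    obtain ⟨x, hxU, hxT⟩ := exists_mem_notMem_of_card_lt_card (s := T) (t := U) (by lia)
    have hxX := hUX hxU
    rw [hX, mem_erase, mem_range] at hxX
    have hins := hs _ hT N (mem_insert_self _ _) x hxX.2 (by simp [hxT]; lia)
    rw [erase_insert hNT] at hins
    have hUeq : insert x T = U :=
      eq_of_subset_of_card_le (insert_subset hxU hTU) (by rw [card_insert_of_notMem hxT]; lia)
    rw [hUeq] at hins
    have h0U : 0 ∉ U := fun h => by simpa [hX] using hUX h
    have hNU : N ∉ U := fun h => by simpa [hX] using hUX h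
    exact hUB (mem_filter.2 ⟨mem_filter.2 ⟨hins, hNU⟩, h0U⟩)
  have := card_add_choose_le hA hB1 hcross (by lia) (p := p) (by lia) (by lia)
    (by rwa [hXc, show N - 1 - (k - 1) = N - k by lia])
  rw [hXc, Nat.choose_symm (by lia)] at this
  lia

/-- The bound for shifted families that are far from a star centred at `0`. -/
lemma IsShifted.card_add_choose_le (hk : 1 ≤ k) (hn : 2 * k ≤ n)
    (hF : F ⊆ (range n).powersetCard k) (hs : IsShifted F)
    (hint : ∀ S ∈ F, ∀ T ∈ F, (S ∩ T).Nonempty)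
    (hB : (n - 3).choose (n - k - 1) < #(F.filter (0 ∉ ·))) :
    #F + (n - 3).choose (k - 1) ≤ (n - 1).choose (k - 1) + (n - 3).choose (n - k - 1) := by
  induction n generalizing k F with
  | zero => lia
  | succ N ih =>
  rcases hn.eq_or_lt with hn | hn
  · have h := two_mul_card_le (hn ▸ hF) hint
    rw [hn, Nat.choose_eq_choose_pred_add (by lia) (by lia),
      Nat.choose_symm_of_eq_add (show N + 1 - 1 = k + (k - 1) by lia)] at h
    rw [show N + 1 - k - 1 = k - 1 by lia]
    lia
  obtain ⟨S₀, hS₀⟩ := card_pos.1 (Nat.zero_lt_of_lt hB)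
  rcases hk.eq_or_lt with rfl | hk
  · obtain ⟨hS₀, h0⟩ := mem_filter.1 hS₀
    obtain ⟨x, rfl⟩ := card_eq_one.1 (mem_powersetCard.1 (hF hS₀)).2
    have hx : 0 ≠ x := by simpa using h0
    have h := hs _ hS₀ x (mem_singleton_self x) 0 (by lia) h0
    obtain ⟨z, hz⟩ := hint _ hS₀ _ h
    simp at hz
    lia
  obtain ⟨M, rfl⟩ : ∃ M, N = M + 3 := ⟨N - 3, by lia⟩
  have hXN : (range (M + 3 + 1)).erase (M + 3) = range (M + 3) := by
    rw [range_add_one, erase_insert notMem_range_self]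
  have hF0 := filter_subset_powersetCard (x := M + 3) hF
  have hF1 := link_subset_powersetCard (x := M + 3) hF
  rw [hXN] at hF0 hF1
  have hs0 := hs.filter_notMem hF
  have hs1 := hs.link hF
  have hint1 := hs.inter_nonempty_link hF hint (by lia) (by lia)
  have hup := hs.choose_le_card (p := M) hF (by lia) (by lia)
  have hB01 := card_link_add_card_filter (x := M + 3) (F := F.filter (0 ∉ ·))
  rw [link_filter (by lia), filter_comm] at hB01
  have hF01 := card_link_add_card_filter (x := M + 3) (F := F)
  have hint0 : ∀ S ∈ F.filter (M + 3 ∉ ·), ∀ T ∈ F.filter (M + 3 ∉ ·), (S ∩ T).Nonempty :=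
    fun S hS T hT => hint S (mem_filter.1 hS).1 T (mem_filter.1 hT).1
  have hcr : ∀ S ∈ IntersectingFamily.link 0 (IntersectingFamily.link (M + 3) F),
      ∀ T ∈ (F.filter (M + 3 ∉ ·)).filter (0 ∉ ·), (S ∩ T).Nonempty := by
    intro S hS T hT
    simp only [mem_link, mem_filter] at hS hT
    obtain ⟨z, hz⟩ := hint _ hS.2.2 _ hT.1.1
    refine ⟨z, ?_⟩
    simp only [mem_inter, mem_insert] at hz ⊢
    grind
  set F0 := F.filter (M + 3 ∉ ·)
  set F1 := IntersectingFamily.link (M + 3) F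
  have hXc : #((range (M + 3)).erase 0) = M + 2 := by
    rw [card_erase_of_mem (by simp), card_range]
    lia
  have e0 := card_link_add_card_filter (x := 0) (F := F0)
  have e1 := card_link_add_card_filter (x := 0) (F := F1)
  have p1 : (M + 1).choose (M + 3 - k) = M.choose (M + 2 - k) + M.choose (M + 3 - k) := by
    rw [show M + 3 - k = M + 2 - k + 1 by lia, Nat.choose_succ_succ]
  have p2 : (M + 1).choose (k - 1) = M.choose (k - 2) + M.choose (k - 1) := by
    rw [show k - 1 = k - 2 + 1 by lia, Nat.choose_succ_succ]
  have p3 : (M + 3).choose (k - 1) = (M + 2).choose (k - 2) + (M + 2).choose (k - 1) := by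
    rw [show k - 1 = k - 2 + 1 by lia, Nat.choose_succ_succ]
  have i0 := ih (k := k) (by lia) (by lia) hF0 hs0 hint0
  have i1 := ih (k := k - 1) (by lia) (by lia) hF1 hs1 hint1
  simp only [show M + 3 + 1 - 3 = M + 1 by lia, show M + 3 + 1 - k - 1 = M + 3 - k by lia,
    show M + 3 - 3 = M by lia, show M + 3 - k - 1 = M + 2 - k by lia,
    show M + 3 - (k - 1) - 1 = M + 3 - k by lia, show k - 1 - 1 = k - 2 by lia,
    show M + 3 - 1 = M + 2 by lia, Nat.add_sub_cancel] at *
  have T1 : #F1 + M.choose (k - 2) ≤ (M + 2).choose (k - 2) + M.choose (M + 3 - k) := by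
    by_cases hb : M.choose (M + 3 - k) < #(F1.filter (0 ∉ ·))
    · exact i1 hb
    have := IntersectingFamily.card_add_choose_le (link_subset_powersetCard (x := 0) hF1)
      (filter_subset_powersetCard (x := 0) hF0) hcr (p := M) (by lia) (by lia) (by lia)
      (by rw [hXc]; lia)
    rw [hXc, show k - 1 - 1 = k - 2 by lia] at this
    lia
  have T0 : #F0 + M.choose (k - 1) ≤ (M + 2).choose (k - 1) + M.choose (M + 2 - k) := by
    by_cases hb : M.choose (M + 2 - k) < #(F0.filter (0 ∉ ·))
    · exact i0 hb
    obtain rfl | hk3 : k = 2 ∨ 3 ≤ k := by lia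
    · have h0 : M.choose (M + 3 - 2) = 0 := Nat.choose_eq_zero_of_lt (by lia)
      have hle := card_filter_le F1 (0 ∉ ·)
      simp only [Nat.sub_self, Nat.choose_zero_right] at T1
      lia
    have hb0 := hup (by lia) (by lia) (by lia)
    have := IntersectingFamily.card_add_choose_le (link_subset_powersetCard (x := 0) hF0)
      (filter_subset_powersetCard (x := 0) hF0) ?_ (p := M) (by lia) (by lia) (by lia)
      (by rw [hXc]; lia)
    · rw [hXc] at this
      lia
    · intro S hS T hT
      simp only [mem_link, mem_filter] at hS hT
      obtain ⟨z, hz⟩ := hint0 _ hS.2 _ hT.1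
      refine ⟨z, ?_⟩
      simp only [mem_inter, mem_insert] at hz ⊢
      grind
  lia

end Shifted

section Bound

variable {n k i v x y : ℕ} {F : Finset (Finset ℕ)}

/-- The bound for families in which the number of sets missing some point `v` is moderate. -/
lemma card_add_choose_le_of_filter_le (hk : 2 ≤ k) (hn : 2 * k < n) (hi : 3 ≤ i) (hik : i ≤ k + 1)
    (hF : F ⊆ (range n).powersetCard k) (hint : ∀ S ∈ F, ∀ T ∈ F, (S ∩ T).Nonempty) (hv : v < n)
    (hle : (n - i).choose (n - k - 1) ≤ #(F.filter (v ∉ ·)))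
    (hge : #(F.filter (v ∉ ·)) ≤ (n - 3).choose (n - k - 1)) :
    #F + (n - i).choose (k - 1) ≤ (n - 1).choose (k - 1) + (n - i).choose (n - k - 1) := by
  have hX : #((range n).erase v) = n - 1 := by
    rw [card_erase_of_mem (mem_range.2 hv), card_range]
  have hcross : ∀ S ∈ link v F, ∀ T ∈ F.filter (v ∉ ·), (S ∩ T).Nonempty := by
    intro S hS T hT
    rw [mem_link] at hS
    rw [mem_filter] at hT
    obtain ⟨z, hz⟩ := hint _ hS.2 _ hT.1
    refine ⟨z, ?_⟩
    simp only [mem_inter, mem_insert] at hz ⊢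
    grind
  have hr : n - 1 - k = n - k - 1 := by lia
  have := card_add_card_add_choose_le (link_subset_powersetCard hF) (filter_subset_powersetCard hF)
    hcross (p := n - i) (q := n - 3) (by lia) (by lia) (by lia) (by lia) (by lia)
    (by rwa [hX, hr]) (by rwa [hX, hr])
  rw [hX, hr, card_link_add_card_filter] at this
  exact this

/-- The bound for families with many sets missing `x`, many missing `y`, but few missing both. -/
lemma card_add_choose_le_of_filter_filter_lt (hk : 3 ≤ k) (hn : 2 * k < n)
    (hF : F ⊆ (range n).powersetCard k) (hint : ∀ S ∈ F, ∀ T ∈ F, (S ∩ T).Nonempty)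
    (hx : x < n) (hy : y < n) (hxy : x ≠ y)
    (hFx : (n - 3).choose (n - k - 1) < #(F.filter (x ∉ ·)))
    (hFy : (n - 3).choose (n - k - 1) < #(F.filter (y ∉ ·)))
    (hFxy : #((F.filter (x ∉ ·)).filter (y ∉ ·)) < (n - 4).choose (n - k - 1)) :
    #F + (n - 4).choose (k - 1) ≤ (n - 1).choose (k - 1) + (n - 4).choose (n - k - 1) := by
  have hX : #(((range n).erase x).erase y) = n - 2 := by
    rw [card_erase_of_mem (mem_erase.2 ⟨hxy.symm, mem_range.2 hy⟩),
      card_erase_of_mem (mem_range.2 hx), card_range]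
    lia
  have hC := link_subset_powersetCard (x := y) (link_subset_powersetCard (x := x) hF)
  have hP := filter_subset_powersetCard (x := y) (link_subset_powersetCard (x := x) hF)
  have hQ := link_subset_powersetCard (x := y) (filter_subset_powersetCard (x := x) hF)
  have hD := filter_subset_powersetCard (x := y) (filter_subset_powersetCard (x := x) hF)
  have eF := card_link_add_card_filter (x := x) (F := F)
  have ex := card_link_add_card_filter (x := y) (F := F.filter (x ∉ ·))
  have el := card_link_add_card_filter (x := y) (F := link x F)
  have ey := card_link_add_card_filter (x := x) (F := F.filter (y ∉ ·))
  rw [link_filter hxy, filter_comm] at ey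
  have hCD : ∀ S ∈ link y (link x F), ∀ T ∈ (F.filter (x ∉ ·)).filter (y ∉ ·),
      (S ∩ T).Nonempty := by
    intro S hS T hT
    simp only [mem_link, mem_filter] at hS hT
    obtain ⟨z, hz⟩ := hint _ hS.2.2 _ hT.1.1
    refine ⟨z, ?_⟩
    simp only [mem_inter, mem_insert] at hz ⊢
    grind
  have hPQ : ∀ S ∈ (link x F).filter (y ∉ ·), ∀ T ∈ link y (F.filter (x ∉ ·)),
      (S ∩ T).Nonempty := by
    intro S hS T hT
    simp only [mem_link, mem_filter, mem_insert] at hS hT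
    obtain ⟨z, hz⟩ := hint _ hS.1.2 _ hT.2.1
    refine ⟨z, ?_⟩
    simp only [mem_inter, mem_insert] at hz ⊢
    grind
  have hQP : ∀ S ∈ link y (F.filter (x ∉ ·)), ∀ T ∈ (link x F).filter (y ∉ ·),
      (S ∩ T).Nonempty := fun S hS T hT => inter_comm T S ▸ hPQ T hT S hS
  have hr : n - 2 - (k - 1) = n - k - 1 := by lia
  have ht : (n - 4).choose (n - k - 1) ≤ (n - 4).choose (n - 2 - k) :=
    choose_le_choose_of_le_add (by lia) (by lia)
  have pascal3 : (n - 3).choose (n - k - 1) =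
      (n - 4).choose (n - 2 - k) + (n - 4).choose (n - k - 1) := by
    rw [show n - 3 = n - 4 + 1 by lia, show n - k - 1 = n - 2 - k + 1 by lia,
      Nat.choose_succ_succ]
  have pascal1 : (n - 1).choose (k - 1) = (n - 2).choose (k - 2) + (n - 2).choose (k - 1) := by
    rw [show n - 1 = n - 2 + 1 by lia, show k - 1 = k - 2 + 1 by lia, Nat.choose_succ_succ]
  have hCDle := card_add_card_le hC hD hCD (q := n - 4) (by lia) (by lia) (by lia)
    (by rw [hX]; lia)
  rw [hX, show k - 1 - 1 = k - 2 by lia] at hCDle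
  rcases le_or_gt #(link y (F.filter (x ∉ ·))) ((n - 3).choose (n - k - 1)) with hQle | hQgt
  · have := card_add_card_add_choose_le hP hQ hPQ (p := n - 4) (q := n - 3) (by lia) (by lia)
      (by lia) (by lia) (by lia) (by rw [hX, hr]; lia) (by rwa [hX, hr])
    rw [hX, hr] at this
    lia
  rcases le_or_gt #((link x F).filter (y ∉ ·)) ((n - 3).choose (n - k - 1)) with hPle | hPgt
  · have := card_add_card_add_choose_le hQ hP hQP (p := n - 4) (q := n - 3) (by lia) (by lia)
      (by lia) (by lia) (by lia) (by rw [hX, hr]; lia) (by rwa [hX, hr])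
    rw [hX, hr] at this
    lia
  · have := card_add_choose_le hP hQ hPQ (p := n - 3) (by lia) (by lia) (by lia)
      (by rw [hX, hr]; lia)
    rw [hX] at this
    have pascal2 : (n - 2).choose (k - 1) = (n - 3).choose (k - 2) + (n - 3).choose (k - 1) := by
      rw [show n - 2 = n - 3 + 1 by lia, show k - 1 = k - 2 + 1 by lia, Nat.choose_succ_succ]
    have hsymm : (n - 3).choose (n - k - 1) = (n - 3).choose (k - 2) :=
      Nat.choose_symm_of_eq_add (by lia)
    lia

/-- Replace `y` by `x` in `S`, unless this is impossible or yields a member of `F`. -/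
def shiftSet (F : Finset (Finset ℕ)) (x y : ℕ) (S : Finset ℕ) : Finset ℕ :=
  if y ∈ S ∧ x ∉ S ∧ insert x (S.erase y) ∉ F then insert x (S.erase y) else S

lemma injOn_shiftSet : Set.InjOn (shiftSet F x y) F := by
  intro S hS T hT h
  rw [mem_coe] at hS hT
  unfold shiftSet at h
  split_ifs at h with h₁ h₂ h₂
  · rw [← insert_erase h₁.1, ← insert_erase h₂.1,
      ← erase_insert (a := x) (s := S.erase y) (by simp [h₁.2.1]), h,
      erase_insert (by simp [h₂.2.1])]
  · exact absurd (h ▸ hT) h₁.2.2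
  · exact absurd (h ▸ hS) h₂.2.2
  · exact h

lemma shiftSet_mem_powersetCard {S : Finset ℕ} (hx : x < n) (hS : S ∈ (range n).powersetCard k) :
    shiftSet F x y S ∈ (range n).powersetCard k := by
  unfold shiftSet
  split_ifs with h
  · obtain ⟨hSn, hSk⟩ := mem_powersetCard.1 hS
    refine mem_powersetCard.2
      ⟨insert_subset (mem_range.2 hx) ((erase_subset _ _).trans hSn), ?_⟩
    rw [card_insert_of_notMem (by simp [h.2.1]), card_erase_add_one h.1, hSk]
  · exact hS

lemma inter_nonempty_shiftSet (hint : ∀ S ∈ F, ∀ T ∈ F, (S ∩ T).Nonempty) {S T : Finset ℕ}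
    (hS : S ∈ F) (hT : T ∈ F) : (shiftSet F x y S ∩ shiftSet F x y T).Nonempty := by
  have key : ∀ S ∈ F, ∀ T ∈ F, x ∉ S → ¬(y ∈ T ∧ x ∉ T ∧ insert x (T.erase y) ∉ F) →
      (insert x (S.erase y) ∩ T).Nonempty := by
    intro S hS T hT hxS h
    by_cases hxT : x ∈ T
    · exact ⟨x, by simp [hxT]⟩
    by_cases hyT : y ∈ T
    · obtain ⟨z, hz⟩ := hint S hS _ (by_contra fun h' => h ⟨hyT, hxT, h'⟩)
      refine ⟨z, ?_⟩
      simp only [mem_inter, mem_insert, mem_erase] at hz ⊢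
      grind
    · obtain ⟨z, hz⟩ := hint S hS T hT
      refine ⟨z, ?_⟩
      simp only [mem_inter, mem_insert, mem_erase] at hz ⊢
      grind
  unfold shiftSet
  split_ifs with h₁ h₂ h₂
  · exact ⟨x, by simp⟩
  · exact key S hS T hT h₁.2.1 h₂
  · rw [inter_comm]
    exact key T hT S hS h₂.2.1 h₁
  · exact hint S hS T hT

lemma card_filter_le_card_filter_image_shiftSet (hvx : v ≠ x) :
    #(F.filter (v ∉ ·)) ≤ #((F.image (shiftSet F x y)).filter (v ∉ ·)) := by
  rw [← card_image_of_injOn (injOn_shiftSet.mono (coe_subset.2 (filter_subset (v ∉ ·) F)))]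
  refine card_le_card fun S hS => ?_
  obtain ⟨T, hT, rfl⟩ := mem_image.1 hS
  obtain ⟨hT, hv⟩ := mem_filter.1 hT
  refine mem_filter.2 ⟨mem_image_of_mem _ hT, ?_⟩
  unfold shiftSet
  split_ifs
  · simp [hvx, hv]
  · exact hv

lemma filter_filter_subset_filter_image_shiftSet :
    (F.filter (x ∉ ·)).filter (y ∉ ·) ⊆ (F.image (shiftSet F x y)).filter (x ∉ ·) := by
  intro S hS
  simp only [mem_filter] at hS
  refine mem_filter.2 ⟨mem_image.2 ⟨S, hS.1.1, ?_⟩, hS.1.2⟩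
  exact if_neg fun h => hS.2 h.1

lemma sum_sum_image_shiftSet_lt {S : Finset ℕ} (hxy : x < y) (hS : S ∈ F) (hy : y ∈ S)
    (hx : x ∉ S) (hSF : insert x (S.erase y) ∉ F) :
    ∑ T ∈ F.image (shiftSet F x y), ∑ t ∈ T, t < ∑ T ∈ F, ∑ t ∈ T, t := by
  have key : ∀ T : Finset ℕ, y ∈ T → x ∉ T → ∑ t ∈ insert x (T.erase y), t < ∑ t ∈ T, t := by
    intro T hyT hxT
    rw [sum_insert (by simp [hxT]), ← add_sum_erase T (fun t => t) hyT]
    lia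
  rw [sum_image injOn_shiftSet]
  refine sum_lt_sum (fun T _ => ?_) ⟨S, hS, ?_⟩
  · unfold shiftSet
    split_ifs with h
    · exact (key T h.1 h.2.1).le
    · exact le_rfl
  · rw [shiftSet, if_pos ⟨hy, hx, hSF⟩]
    exact key S hy hx

/-- The bound for families far from every star. -/
lemma card_add_choose_le_of_lt_filter (hk : 3 ≤ k) (hn : 2 * k < n)
    (hF : F ⊆ (range n).powersetCard k) (hint : ∀ S ∈ F, ∀ T ∈ F, (S ∩ T).Nonempty)
    (hdeg : ∀ v < n, (n - 3).choose (n - k - 1) < #(F.filter (v ∉ ·))) :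
    #F + (n - 4).choose (k - 1) ≤ (n - 1).choose (k - 1) + (n - 4).choose (n - k - 1) := by
  induction h : ∑ T ∈ F, ∑ t ∈ T, t using Nat.strong_induction_on generalizing F with
  | _ m ih =>
  by_cases hs : IsShifted F
  · have := hs.card_add_choose_le (by lia) hn.le hF hint (hdeg 0 (by lia))
    rw [show n - 3 = n - 4 + 1 by lia, show k - 1 = k - 2 + 1 by lia, Nat.choose_succ_succ,
      show n - k - 1 = n - k - 2 + 1 by lia, Nat.choose_succ_succ,
      Nat.choose_symm_of_eq_add (show n - 4 = (n - k - 2) + (k - 2) by lia)] at this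
    rw [show k - 1 = k - 2 + 1 by lia, show n - k - 1 = n - k - 2 + 1 by lia]
    lia
  simp only [IsShifted, not_forall, exists_prop] at hs
  obtain ⟨S, hS, y, hy, x, hxy, hx, hSF⟩ := hs
  have hyn : y < n := mem_range.1 ((mem_powersetCard.1 (hF hS)).1 hy)
  have hF' : F.image (shiftSet F x y) ⊆ (range n).powersetCard k :=
    image_subset_iff.2 fun T hT => shiftSet_mem_powersetCard (by lia) (hF hT)
  have hint' : ∀ S ∈ F.image (shiftSet F x y), ∀ T ∈ F.image (shiftSet F x y),
      (S ∩ T).Nonempty := by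
    simp only [forall_mem_image]
    exact fun S hS T hT => inter_nonempty_shiftSet hint hS hT
  rw [← card_image_of_injOn (injOn_shiftSet (F := F) (x := x) (y := y))]
  rcases lt_or_ge ((n - 3).choose (n - k - 1)) #((F.image (shiftSet F x y)).filter (x ∉ ·))
    with hgt | hle
  · refine ih _ (h ▸ sum_sum_image_shiftSet_lt hxy hS hy hx hSF) hF' hint' (fun v hv => ?_) rfl
    by_cases hvx : v = x
    · rwa [hvx]
    · exact (hdeg v hv).trans_le (card_filter_le_card_filter_image_shiftSet hvx)
  rcases le_or_gt ((n - 4).choose (n - k - 1)) #((F.image (shiftSet F x y)).filter (x ∉ ·))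
    with hge | hlt
  · exact card_add_choose_le_of_filter_le (by lia) hn (by lia) (by lia) hF' hint'
      (hxy.trans hyn) hge hle
  · rw [card_image_of_injOn injOn_shiftSet]
    exact card_add_choose_le_of_filter_filter_lt hk hn hF hint (hxy.trans hyn) hyn hxy.ne
      (hdeg x (hxy.trans hyn)) (hdeg y hyn)
      ((card_le_card filter_filter_subset_filter_image_shiftSet).trans_lt hlt)

lemma choose_add_choose_le (hk : 3 ≤ k) (hn : 2 * k < n) (hi : 4 ≤ i) (hik : i ≤ k + 1) :
    (n - i).choose (k - 1) + (n - 4).choose (n - k - 1) ≤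
      (n - 4).choose (k - 1) + (n - i).choose (n - k - 1) := by
  induction i, hi using Nat.le_induction with
  | base => lia
  | succ i hi ih =>
    have ih := ih (by lia)
    rw [show n - i = n - (i + 1) + 1 by lia, show k - 1 = k - 2 + 1 by lia,
      show n - k - 1 = n - k - 2 + 1 by lia, Nat.choose_succ_succ, Nat.choose_succ_succ] at ih
    rw [show k - 1 = k - 2 + 1 by lia, show n - k - 1 = n - k - 2 + 1 by lia]
    have : (n - (i + 1)).choose (n - k - 2) ≤ (n - (i + 1)).choose (k - 2) :=
      choose_le_choose_of_le_add (by lia) (by lia)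
    lia

/-- The bound for intersecting families of which every star misses enough sets. -/
lemma card_add_choose_le_of_forall_le (hn : 2 * k < n) (hi : 4 ≤ i) (hik : i ≤ k + 1)
    (hF : F ⊆ (range n).powersetCard k) (hint : ∀ S ∈ F, ∀ T ∈ F, (S ∩ T).Nonempty)
    (hdeg : ∀ v < n, (n - i).choose (n - k - 1) ≤ #(F.filter (v ∉ ·))) :
    #F + (n - i).choose (k - 1) ≤ (n - 1).choose (k - 1) + (n - i).choose (n - k - 1) := by
  by_cases hall : ∀ v < n, (n - 3).choose (n - k - 1) < #(F.filter (v ∉ ·))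
  · have := card_add_choose_le_of_lt_filter (by lia) hn hF hint hall
    have := choose_add_choose_le (by lia) hn hi hik
    lia
  · push Not at hall
    obtain ⟨v, hv, hle⟩ := hall
    exact card_add_choose_le_of_filter_le (by lia) hn (by lia) hik hF hint hv (hdeg v hv) hle

end Bound

end IntersectingFamily

theorem stmt_16 (n k i : ℕ) (hk : 0 < k) (hn : 2 * k < n)
    (hi4 : 4 ≤ i) (hik : i ≤ k + 1)
    (F : Finset (Finset (Fin n)))
    (hFk : ∀ S ∈ F, S.card = k)
    (hint : ∀ S ∈ F, ∀ T ∈ F, (S ∩ T).Nonempty)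
    (hdeg : (n - i).choose (k - i + 1) ≤ F.card - maxDeg F) :
    F.card ≤ (n - 1).choose (k - 1) - (n - i).choose (k - 1)
      + (n - i).choose (k - i + 1) := by
  have hinj : Function.Injective fun S : Finset (Fin n) => S.map Fin.valEmbedding :=
    Finset.map_injective _
  have hsymm : (n - i).choose (n - k - 1) ≤ (n - i).choose (k - i + 1) := by
    rcases hik.eq_or_lt with rfl | hik
    · rw [show n - (k + 1) = n - k - 1 by lia, Nat.choose_self]
      exact Nat.choose_pos (by lia)
    · exact (Nat.choose_symm_of_eq_add (by lia)).le
  have := IntersectingFamily.card_add_choose_le_of_forall_le (k := k) (i := i)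
    (F := F.image fun S => S.map Fin.valEmbedding) hn hi4 hik ?_ ?_ ?_
  · rw [Finset.card_image_of_injective _ hinj] at this
    have hle : (n - i).choose (k - 1) ≤ (n - 1).choose (k - 1) :=
      Nat.choose_le_choose _ (by lia)
    lia
  · refine Finset.image_subset_iff.2 fun S hS => Finset.mem_powersetCard.2 ⟨fun a ha => ?_, ?_⟩
    · obtain ⟨b, -, rfl⟩ := Finset.mem_map.1 ha
      exact Finset.mem_range.2 b.2
    · rw [Finset.card_map, hFk S hS]
  · simp only [Finset.forall_mem_image]
    intro S hS T hT
    rw [← Finset.map_inter]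
    exact (hint S hS T hT).map
  · intro v hv
    have hfilter : (F.image fun S => S.map Fin.valEmbedding).filter (v ∉ ·) =
        (F.filter ((⟨v, hv⟩ : Fin n) ∉ ·)).image fun S => S.map Fin.valEmbedding := by
      rw [Finset.filter_image]
      congr 1
      refine Finset.filter_congr fun S _ => not_congr ?_
      exact Finset.mem_map' (a := (⟨v, hv⟩ : Fin n)) Fin.valEmbedding
    rw [hfilter, Finset.card_image_of_injective _ hinj]
    have hmax : (F.filter fun S => (⟨v, hv⟩ : Fin n) ∈ S).card ≤ maxDeg F :=
      Finset.le_sup (f := fun l : Fin n => (F.filter fun S => l ∈ S).card)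
        (Finset.mem_univ _)
    have hsplit := F.card_filter_add_card_filter_not fun S => (⟨v, hv⟩ : Fin n) ∈ S
    lia
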